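/- Let C(l) := sup_{k≥1} k^{2/l} e_k(N(0,I_l))² and Q(l) := lim_{k→∞} k^{2/l} e_k(N(0,I_l))². Then lim_{l→∞} C(l)/l = lim_{l→∞} Q(l)/l = inf_{l≥1} C(l)/l = inf_{l≥1} Q(l)/l = 1. -/

import Mathlib

open MeasureTheory ProbabilityTheory Real Filter

noncomputable section

/-- Minimal `n`-th `L²` quantization error of a probability measure `μ` on a normed space. -/
def quantErrMeas {E : Type*} [NormedAddCommGroup E] [MeasurableSpace E]
    (μ : Measure E) (n : ℕ) : ℝ :=
  sInf { r : ℝ | ∃ α : Finset E, α.Nonempty ∧ α.card ≤ n ∧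
    r = (∫ x, (⨅ a : α, ‖x - (a : E)‖ ^ 2) ∂μ) ^ (1/2 : ℝ) }

/-- The standard Gaussian distribution `N(0, I_l)` on `ℝ^l` with the Euclidean norm. -/
def stdGaussian (l : ℕ) : Measure (EuclideanSpace ℝ (Fin l)) :=
  (Measure.pi fun _ : Fin l => gaussianReal 0 1).map (EuclideanSpace.equiv (Fin l) ℝ).symm

/-- `C(l) := sup_{k ≥ 1} k^{2/l} e_k(N(0,I_l))²`. -/
def Cconst (l : ℕ) : ℝ :=
  sSup { x : ℝ | ∃ k : ℕ, 1 ≤ k ∧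
    x = (k : ℝ) ^ (2 / (l : ℝ)) * (quantErrMeas (stdGaussian l) k) ^ 2 }

lemma stdGaussian_eq_stdGaussian (l : ℕ) :
    _root_.stdGaussian l = ProbabilityTheory.stdGaussian (EuclideanSpace ℝ (Fin l)) := by
  rw [← map_pi_eq_stdGaussian]
  rfl

instance (l : ℕ) : IsProbabilityMeasure (_root_.stdGaussian l) := by
  rw [stdGaussian_eq_stdGaussian]
  infer_instance

instance (l : ℕ) : IsGaussian (_root_.stdGaussian l) := by
  rw [stdGaussian_eq_stdGaussian]
  infer_instance

/-- The density of `N(0, I_l)`. -/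
def gaussianDensity (l : ℕ) (z : EuclideanSpace ℝ (Fin l)) : ℝ :=
  ((2 * π) ^ ((l : ℝ) / 2))⁻¹ * rexp (-(1 / 2) * ‖z‖ ^ 2)

lemma gaussianDensity_pos {l : ℕ} (z : EuclideanSpace ℝ (Fin l)) : 0 < gaussianDensity l z := by
  unfold gaussianDensity; positivity

@[fun_prop]
lemma continuous_gaussianDensity (l : ℕ) : Continuous (gaussianDensity l) := by
  unfold gaussianDensity; fun_prop

lemma integrable_exp_neg_mul_sq_norm {l : ℕ} {b : ℝ} (hb : 0 < b) :
    Integrable (fun v : EuclideanSpace ℝ (Fin l) => rexp (-b * ‖v‖ ^ 2)) := by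
  refine Integrable.of_integral_ne_zero ?_
  rw [GaussianFourier.integral_rexp_neg_mul_sq_norm hb]
  positivity

lemma integrable_gaussianDensity (l : ℕ) : Integrable (gaussianDensity l) :=
  (integrable_exp_neg_mul_sq_norm (by norm_num)).const_mul _

lemma stdGaussian_eq_withDensity (l : ℕ) :
    _root_.stdGaussian l =
      volume.withDensity (fun z => ENNReal.ofReal (gaussianDensity l z)) := by
  have : IsFiniteMeasure (volume.withDensity (fun z => ENNReal.ofReal (gaussianDensity l z))) :=
    isFiniteMeasure_withDensity_ofReal (integrable_gaussianDensity l).2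
  rw [stdGaussian_eq_stdGaussian]
  apply Measure.ext_of_charFun
  ext t
  rw [charFun_stdGaussian, charFun_apply,
    integral_withDensity_eq_integral_toReal_smul (by fun_prop) (by simp)]
  have h := GaussianFourier.integral_cexp_neg_mul_sq_norm_add (b := 1 / 2) (by norm_num)
    Complex.I t
  have h2 : ∀ z : EuclideanSpace ℝ (Fin l),
      (ENNReal.ofReal (gaussianDensity l z)).toReal • Complex.exp (inner ℝ z t * Complex.I)
        = (((2 * π) ^ ((l : ℝ) / 2))⁻¹ : ℝ) *
          Complex.exp (-(1 / 2) * ‖z‖ ^ 2 + Complex.I * inner ℝ t z) := by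
    intro z
    rw [ENNReal.toReal_ofReal (gaussianDensity_pos z).le, gaussianDensity, Complex.exp_add,
      Complex.real_smul, real_inner_comm]
    push_cast
    ring_nf
  simp_rw [h2]
  rw [integral_const_mul, h]
  have h3 : ((π : ℂ) / (1 / 2)) ^ (Module.finrank ℝ (EuclideanSpace ℝ (Fin l)) / 2 : ℂ)
      = (((2 * π) ^ ((l : ℝ) / 2) : ℝ) : ℂ) := by
    rw [Complex.ofReal_cpow (by positivity)]
    simp
    ring_nf
  have h4 : (((2 * π) ^ ((l : ℝ) / 2) : ℝ) : ℂ) ≠ 0 := by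
    rw [Complex.ofReal_ne_zero]; positivity
  rw [h3, Complex.ofReal_inv, inv_mul_cancel_left₀ h4, Complex.I_sq]
  ring_nf

lemma integral_stdGaussian {l : ℕ} (f : EuclideanSpace ℝ (Fin l) → ℝ) :
    ∫ z, f z ∂_root_.stdGaussian l = ∫ z, gaussianDensity l z * f z := by
  rw [stdGaussian_eq_withDensity,
    integral_withDensity_eq_integral_toReal_smul (by fun_prop) (by simp)]
  simp [ENNReal.toReal_ofReal (gaussianDensity_pos _).le]

lemma integrable_stdGaussian_iff {l : ℕ} (f : EuclideanSpace ℝ (Fin l) → ℝ) :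
    Integrable f (_root_.stdGaussian l) ↔ Integrable (fun z => gaussianDensity l z * f z) := by
  rw [stdGaussian_eq_withDensity,
    integrable_withDensity_iff_integrable_smul' (by fun_prop) (by simp)]
  simp [ENNReal.toReal_ofReal (gaussianDensity_pos _).le]

lemma gaussianDensity_mul_exp {l : ℕ} (a : ℝ) (z : EuclideanSpace ℝ (Fin l)) :
    gaussianDensity l z * rexp (a * ‖z‖ ^ 2)
      = ((2 * π) ^ ((l : ℝ) / 2))⁻¹ * rexp (-(1 / 2 - a) * ‖z‖ ^ 2) := by
  rw [gaussianDensity, mul_assoc, ← Real.exp_add]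
  ring_nf

lemma integrable_exp_mul_sq_norm_stdGaussian {l : ℕ} {a : ℝ} (ha : a < 1 / 2) :
    Integrable (fun z => rexp (a * ‖z‖ ^ 2)) (_root_.stdGaussian l) := by
  rw [integrable_stdGaussian_iff]
  simp_rw [gaussianDensity_mul_exp]
  exact (integrable_exp_neg_mul_sq_norm (by linarith)).const_mul _

lemma integral_exp_mul_sq_norm_stdGaussian {l : ℕ} {a : ℝ} (ha : a < 1 / 2) :
    ∫ z, rexp (a * ‖z‖ ^ 2) ∂_root_.stdGaussian l = (1 - 2 * a) ^ (-(l : ℝ) / 2) := by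
  rw [integral_stdGaussian]
  simp_rw [gaussianDensity_mul_exp]
  rw [integral_const_mul, GaussianFourier.integral_rexp_neg_mul_sq_norm (by linarith),
    finrank_euclideanSpace, Fintype.card_fin, neg_div, Real.rpow_neg (by linarith),
    ← Real.inv_rpow (by positivity), ← Real.inv_rpow (by linarith),
    ← Real.mul_rpow (by positivity) (div_nonneg pi_pos.le (by linarith))]
  congr 1
  have : (1 : ℝ) / 2 - a ≠ 0 := by linarith
  have : (1 : ℝ) - 2 * a ≠ 0 := by linarith
  field_simp

lemma integrable_sq_norm_stdGaussian (l : ℕ) :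
    Integrable (fun z => ‖z‖ ^ 2) (_root_.stdGaussian l) :=
  (IsGaussian.memLp_two_id (μ := _root_.stdGaussian l)).integrable_norm_pow (by norm_num)

lemma integrable_sq_norm_sub_stdGaussian {l : ℕ} (a : EuclideanSpace ℝ (Fin l)) :
    Integrable (fun z => ‖z - a‖ ^ 2) (_root_.stdGaussian l) :=
  ((IsGaussian.memLp_two_id (μ := _root_.stdGaussian l)).sub (memLp_const a)).integrable_norm_pow
    (by norm_num)

lemma integral_sq_norm_stdGaussian (l : ℕ) : ∫ z, ‖z‖ ^ 2 ∂_root_.stdGaussian l = l := by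
  unfold _root_.stdGaussian
  rw [integral_map (by fun_prop) (by fun_prop)]
  have h : ∀ x : Fin l → ℝ, ‖(EuclideanSpace.equiv (Fin l) ℝ).symm x‖ ^ 2 = ∑ i, x i ^ 2 := by
    intro x
    rw [EuclideanSpace.norm_sq_eq]
    simp
  have h1 : ∫ x, x ^ 2 ∂gaussianReal 0 1 = 1 := by
    have h := variance_fun_id_gaussianReal (μ := 0) (v := 1)
    rw [variance_of_integral_eq_zero (by fun_prop) (by simp)] at h
    simpa using h
  have h2 : Integrable (fun x : ℝ => x ^ 2) (gaussianReal 0 1) :=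
    (memLp_id_gaussianReal 2).integrable_sq
  simp_rw [h]
  rw [integral_finsetSum]
  · have : ∀ i : Fin l, ∫ a : Fin l → ℝ, a i ^ 2 ∂Measure.pi (fun _ => gaussianReal 0 1) = 1 := by
      intro i
      rw [integral_comp_eval (μ := fun _ : Fin l => gaussianReal 0 1) (f := fun x => x ^ 2)
        (by fun_prop), h1]
    simp [this]
  · intro i _
    exact integrable_comp_eval (μ := fun _ : Fin l => gaussianReal 0 1) (f := fun x => x ^ 2) h2

/-- Chebyshev's inequality for the squared norm of a standard Gaussian vector. -/
lemma stdGaussian_sq_norm_deviation_le {l : ℕ} (hl : 1 ≤ l) {ε : ℝ} (hε : 0 < ε) :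
    (_root_.stdGaussian l).real {z | ε * l ≤ |‖z‖ ^ 2 - l|}
      ≤ Var[fun x => x ^ 2; gaussianReal 0 1] / (ε ^ 2 * l) := by
  have hl' : (0 : ℝ) < l := by exact_mod_cast hl
  have h4 : MemLp (fun z => ‖z‖ ^ 2) 2 (_root_.stdGaussian l) := by
    have := (IsGaussian.memLp_id (_root_.stdGaussian l) 4 (by norm_num)).norm_rpow_div 2
    convert! this using 1
    · ext x; simp
    · rw [show (4 : ENNReal) = 2 * 2 by norm_num, ENNReal.mul_div_cancel_right] <;> simp
  have hV : Var[fun z => ‖z‖ ^ 2; _root_.stdGaussian l]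
      = l * Var[fun x => x ^ 2; gaussianReal 0 1] := by
    unfold _root_.stdGaussian
    rw [variance_map (by fun_prop) (by fun_prop)]
    have hm : MemLp (fun x : ℝ => x ^ 2) 2 (gaussianReal 0 1) := by
      have := (memLp_id_gaussianReal (μ := 0) (v := 1) 4).norm_rpow_div 2
      convert! this using 1
      · ext x; simp
      · rw [show ((4 : NNReal) : ENNReal) = 2 * 2 by norm_num, ENNReal.mul_div_cancel_right] <;> simp
    have := variance_sum_pi (ι := Fin l) (μ := fun _ => gaussianReal 0 1)
      (X := fun _ x => x ^ 2) (fun _ => hm)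
    simp only [Finset.sum_const, Finset.card_univ, Fintype.card_fin, nsmul_eq_mul] at this
    rw [← this]
    congr 1
    ext x
    simp [EuclideanSpace.norm_sq_eq]
  have h := meas_ge_le_variance_div_sq h4 (mul_pos hε hl')
  rw [integral_sq_norm_stdGaussian, hV] at h
  refine (ENNReal.toReal_le_of_le_ofReal ?_ h).trans_eq ?_
  · have := variance_nonneg (fun x : ℝ => x ^ 2) (gaussianReal 0 1)
    positivity
  · field_simp

lemma stdGaussian_inner_deviation_le {l : ℕ} (x : EuclideanSpace ℝ (Fin l)) :
    (_root_.stdGaussian l).real {z | 2 * ‖x‖ < |inner ℝ x z|} ≤ 1 / 4 := by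
  by_cases hx : x = 0
  · simp [hx]
  have hx' : 0 < ‖x‖ := norm_pos_iff.2 hx
  have hm : MemLp (innerSL ℝ x) 2 (_root_.stdGaussian l) :=
    IsGaussian.memLp_dual (_root_.stdGaussian l) (innerSL ℝ x) 2 (by norm_num)
  have h := meas_ge_le_variance_div_sq hm (c := 2 * ‖x‖) (by positivity)
  rw [stdGaussian_eq_stdGaussian, variance_dual_stdGaussian, integral_strongDual_stdGaussian,
    innerSL_apply_norm] at h
  have h2 : (_root_.stdGaussian l).real {z | 2 * ‖x‖ ≤ |innerSL ℝ x z - 0|} ≤ 1 / 4 := by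
    rw [stdGaussian_eq_stdGaussian]
    refine (ENNReal.toReal_le_of_le_ofReal (by positivity) h).trans_eq ?_
    field_simp
    norm_num
  refine (measureReal_mono ?_).trans h2
  intro z hz
  simpa using hz.le

lemma measurableSet_gaussianTypical {l : ℕ} (ε : ℝ) (x : EuclideanSpace ℝ (Fin l)) :
    MeasurableSet {z : EuclideanSpace ℝ (Fin l) |
      |‖z‖ ^ 2 - l| < ε * l ∧ |inner ℝ x z| ≤ 2 * ‖x‖} := by
  have h1 : MeasurableSet {z : EuclideanSpace ℝ (Fin l) | |‖z‖ ^ 2 - l| < ε * l} :=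
    measurableSet_lt (by fun_prop) (by fun_prop)
  have h2 : MeasurableSet {z : EuclideanSpace ℝ (Fin l) | |inner ℝ x z| ≤ 2 * ‖x‖} :=
    measurableSet_le (by fun_prop) (by fun_prop)
  exact h1.inter h2

lemma half_le_stdGaussian_typical {l : ℕ} {ε : ℝ}
    (hdev : (_root_.stdGaussian l).real {z | ε * l ≤ |‖z‖ ^ 2 - l|} ≤ 1 / 4)
    (x : EuclideanSpace ℝ (Fin l)) :
    1 / 2 ≤ (_root_.stdGaussian l).real
      {z | |‖z‖ ^ 2 - l| < ε * l ∧ |inner ℝ x z| ≤ 2 * ‖x‖} := by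
  set S := {z : EuclideanSpace ℝ (Fin l) | |‖z‖ ^ 2 - l| < ε * l ∧ |inner ℝ x z| ≤ 2 * ‖x‖}
    with hS
  have hcompl : Sᶜ ⊆ {z | ε * l ≤ |‖z‖ ^ 2 - l|} ∪ {z | 2 * ‖x‖ < |inner ℝ x z|} := by
    intro z hz
    simp only [hS, Set.mem_compl_iff, Set.mem_ofPred_eq, not_and_or, not_lt, not_le] at hz
    exact hz
  have hmeas : MeasurableSet S := measurableSet_gaussianTypical ε x
  have h1 := (measureReal_mono (μ := _root_.stdGaussian l) hcompl).trans
    (measureReal_union_le _ _)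
  rw [probReal_compl_eq_one_sub hmeas] at h1
  have h2 := stdGaussian_inner_deviation_le x
  linarith

/-- Lower bound for the mass that `N(0, σ² I)` gives to a ball around `x`, obtained by comparing it
with `N(b x, s² I)` on a typical set of the latter. -/
lemma le_stdGaussian_ball {l : ℕ} {ε b s σ t : ℝ} (hs : 0 < s) (hσ : 0 < σ)
    (hb0 : 0 ≤ b) (hb1 : b ≤ 1)
    (hdev : (_root_.stdGaussian l).real {z | ε * l ≤ |‖z‖ ^ 2 - l|} ≤ 1 / 4)
    (x : EuclideanSpace ℝ (Fin l))
    (ht : (1 - b) ^ 2 * ‖x‖ ^ 2 + 4 * (1 - b) * s * ‖x‖ + s ^ 2 * ((1 + ε) * l) ≤ t) :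
    1 / 2 * ((s / σ) ^ l * rexp ((1 - ε) * l / 2
        - (b ^ 2 * ‖x‖ ^ 2 + 4 * b * s * ‖x‖ + s ^ 2 * ((1 + ε) * l)) / (2 * σ ^ 2)))
      ≤ (_root_.stdGaussian l).real {z | ‖x - σ • z‖ ^ 2 ≤ t} := by
  set A := {z : EuclideanSpace ℝ (Fin l) | ‖x - σ • z‖ ^ 2 ≤ t} with hA
  set S := {z : EuclideanSpace ℝ (Fin l) | |‖z‖ ^ 2 - l| < ε * l ∧ |inner ℝ x z| ≤ 2 * ‖x‖}
    with hS
  set κ := rexp ((1 - ε) * l / 2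
        - (b ^ 2 * ‖x‖ ^ 2 + 4 * b * s * ‖x‖ + s ^ 2 * ((1 + ε) * l)) / (2 * σ ^ 2)) with hκ
  have hAm : MeasurableSet A := measurableSet_le (by fun_prop) (by fun_prop)
  have hSm : MeasurableSet S := measurableSet_gaussianTypical ε x
  set h : EuclideanSpace ℝ (Fin l) → ℝ := fun z => gaussianDensity l z * A.indicator 1 z with hh
  have hint : Integrable h := by
    rw [← integrable_stdGaussian_iff]
    exact (integrable_indicator_iff hAm).2 (integrable_const _).integrableOn
  have hAr : (_root_.stdGaussian l).real A = ∫ z, h z := by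
    rw [← integral_stdGaussian, integral_indicator_one hAm]
  have hR : 0 < s / σ := div_pos hs hσ
  have hch : ∫ z, h z = (s / σ) ^ l * ∫ z, h ((s / σ) • z + (b / σ) • x) := by
    rw [Measure.integral_comp_smul volume (fun z => h (z + (b / σ) • x)),
      integral_add_right_eq_self, finrank_euclideanSpace, Fintype.card_fin, abs_of_pos (by positivity),
      smul_eq_mul, mul_inv_cancel_left₀ (by positivity)]
  have hlow : κ * (_root_.stdGaussian l).real S ≤ ∫ z, h ((s / σ) • z + (b / σ) • x) := by
    rw [← integral_indicator_one hSm, ← integral_const_mul, integral_stdGaussian]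
    refine integral_mono ?_ ?_ ?_
    · rw [← integrable_stdGaussian_iff]
      exact ((integrable_indicator_iff hSm).2 (integrable_const _).integrableOn).const_mul _
    · exact (hint.comp_add_right ((b / σ) • x)).comp_smul hR.ne'
    · intro z
      by_cases hz : z ∈ S
      · have hσz : σ • ((s / σ) • z + (b / σ) • x) = s • z + b • x := by
          rw [smul_add, smul_smul, smul_smul, mul_div_cancel₀ _ hσ.ne', mul_div_cancel₀ _ hσ.ne']
        have hz1 := abs_lt.1 hz.1
        have hz2 := abs_le.1 hz.2
        have hmem : (s / σ) • z + (b / σ) • x ∈ A := by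
          refine le_trans ?_ ht
          rw [hσz, show x - (s • z + b • x) = (1 - b) • x - s • z by module, norm_sub_sq_real,
            norm_smul, norm_smul, real_inner_smul_left, real_inner_smul_right, mul_pow, mul_pow,
            Real.norm_eq_abs, Real.norm_eq_abs, sq_abs, sq_abs]
          have e1 : s ^ 2 * ‖z‖ ^ 2 ≤ s ^ 2 * ((1 + ε) * l) := by gcongr; linarith
          have e2 : ((1 - b) * s) * (-inner ℝ x z) ≤ ((1 - b) * s) * (2 * ‖x‖) := by
            refine mul_le_mul_of_nonneg_left (by linarith) (mul_nonneg (by linarith) hs.le)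
          nlinarith
        have hden : gaussianDensity l z * κ ≤ gaussianDensity l ((s / σ) • z + (b / σ) • x) := by
          unfold gaussianDensity
          rw [mul_assoc, hκ, ← Real.exp_add]
          gcongr
          have hn : ‖(s / σ) • z + (b / σ) • x‖ ^ 2
              = (s ^ 2 * ‖z‖ ^ 2 + 2 * (s * b * inner ℝ x z) + b ^ 2 * ‖x‖ ^ 2) / σ ^ 2 := by
            rw [norm_add_sq_real, norm_smul, norm_smul, real_inner_smul_left,
              real_inner_smul_right, mul_pow, mul_pow, Real.norm_eq_abs, Real.norm_eq_abs, sq_abs,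
              sq_abs, real_inner_comm]
            field_simp
          have e1 : s ^ 2 * ‖z‖ ^ 2 ≤ s ^ 2 * ((1 + ε) * l) := by gcongr; linarith
          have e2 : (s * b) * inner ℝ x z ≤ (s * b) * (2 * ‖x‖) := by
            gcongr; linarith
          have e3 : ‖(s / σ) • z + (b / σ) • x‖ ^ 2
              ≤ (b ^ 2 * ‖x‖ ^ 2 + 4 * b * s * ‖x‖ + s ^ 2 * ((1 + ε) * l)) / σ ^ 2 := by
            rw [hn]
            gcongr ?_ / _
            linarith
          have e4 : (b ^ 2 * ‖x‖ ^ 2 + 4 * b * s * ‖x‖ + s ^ 2 * ((1 + ε) * l)) / (2 * σ ^ 2)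
              = (b ^ 2 * ‖x‖ ^ 2 + 4 * b * s * ‖x‖ + s ^ 2 * ((1 + ε) * l)) / σ ^ 2 / 2 := by
            field_simp
          rw [e4]
          linarith
        simpa [hh, hz, hmem] using hden
      · simp only [hh, Set.indicator_of_notMem hz, mul_zero]
        exact mul_nonneg (gaussianDensity_pos _).le (Set.indicator_nonneg (by simp) _)
  rw [hAr, hch]
  have hS2 := half_le_stdGaussian_typical hdev x
  have hκ0 : 0 < κ := Real.exp_pos _
  calc 1 / 2 * ((s / σ) ^ l * κ) = (s / σ) ^ l * (κ * (1 / 2)) := by ring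
    _ ≤ (s / σ) ^ l * (κ * (_root_.stdGaussian l).real S) := by gcongr
    _ ≤ _ := by gcongr

/-- Squared distance from `x` to the nearest point of the codebook `α`. -/
def codeDistSq {E : Type*} [NormedAddCommGroup E] (α : Finset E) (x : E) : ℝ :=
  ⨅ a : α, ‖x - (a : E)‖ ^ 2

section codeDistSq

variable {E : Type*} [NormedAddCommGroup E] {α : Finset E}

lemma codeDistSq_nonneg (α : Finset E) (x : E) : 0 ≤ codeDistSq α x :=
  Real.iInf_nonneg fun _ => by positivity

lemma codeDistSq_le {a : E} (ha : a ∈ α) (x : E) : codeDistSq α x ≤ ‖x - a‖ ^ 2 :=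
  ciInf_le (Set.finite_range _).bddBelow (⟨a, ha⟩ : α)

lemma exists_codeDistSq_eq (hα : α.Nonempty) (x : E) :
    ∃ a ∈ α, ‖x - a‖ ^ 2 = codeDistSq α x := by
  have : Nonempty α := hα.to_subtype
  obtain ⟨a, ha⟩ := exists_eq_ciInf_of_finite (f := fun a : α => ‖x - (a : E)‖ ^ 2)
  exact ⟨a, a.2, ha⟩

lemma codeDistSq_insert_le [DecidableEq E] (hα : α.Nonempty) (y x : E) :
    codeDistSq (insert y α) x ≤ min (codeDistSq α x) (‖x - y‖ ^ 2) := by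
  refine le_min ?_ (codeDistSq_le (Finset.mem_insert_self _ _) x)
  obtain ⟨a, ha, hax⟩ := exists_codeDistSq_eq hα x
  rw [← hax]
  exact codeDistSq_le (Finset.mem_insert_of_mem ha) x

@[fun_prop]
lemma measurable_codeDistSq [MeasurableSpace E] [BorelSpace E] (α : Finset E) :
    Measurable (codeDistSq α) :=
  Measurable.iInf fun a => by
    have : Continuous fun x : E => ‖x - (a : E)‖ ^ 2 := by fun_prop
    exact this.measurable

end codeDistSq

lemma integrable_codeDistSq {l : ℕ} {α : Finset (EuclideanSpace ℝ (Fin l))} (hα : α.Nonempty) :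
    Integrable (codeDistSq α) (_root_.stdGaussian l) := by
  obtain ⟨a, ha⟩ := hα
  refine (integrable_sq_norm_sub_stdGaussian a).mono' (by fun_prop) (.of_forall fun x => ?_)
  rw [Real.norm_of_nonneg (codeDistSq_nonneg _ _)]
  exact codeDistSq_le ha x

/-- One greedy step: a codebook containing `0` can be enlarged by one point (found by averaging over
`N(0, σ² I)`) so that the excess of its distortion over `T` shrinks by the factor `1 - q`. -/
lemma exists_insert_integral_codeDistSq_le {l : ℕ} {α : Finset (EuclideanSpace ℝ (Fin l))}
    (h0 : 0 ∈ α) (σ : ℝ) {q T : ℝ} (hq : 0 ≤ q) {t : EuclideanSpace ℝ (Fin l) → ℝ}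
    (ht : Integrable t (_root_.stdGaussian l)) (hT : ∫ x, t x ∂_root_.stdGaussian l ≤ T)
    (hball : ∀ x, ‖x‖ ^ 2 ≤ t x ∨
      q ≤ (_root_.stdGaussian l).real {z | ‖x - σ • z‖ ^ 2 ≤ t x}) :
    ∃ y, ∫ x, codeDistSq (insert y α) x ∂_root_.stdGaussian l ≤
      ∫ x, codeDistSq α x ∂_root_.stdGaussian l
        - q * (∫ x, codeDistSq α x ∂_root_.stdGaussian l - T) := by
  have hα : α.Nonempty := ⟨0, h0⟩
  have hd := integrable_codeDistSq hα
  set μ := _root_.stdGaussian l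
  set G : EuclideanSpace ℝ (Fin l) → EuclideanSpace ℝ (Fin l) → ℝ :=
    fun z x => min (codeDistSq α x) (‖x - σ • z‖ ^ 2) with hG
  have hG0 : ∀ z x, 0 ≤ G z x := fun z x => le_min (codeDistSq_nonneg _ _) (by positivity)
  have hGd : ∀ z x, G z x ≤ codeDistSq α x := fun z x => min_le_left _ _
  have hGm : Measurable (Function.uncurry G) := by
    have : Continuous fun p : EuclideanSpace ℝ (Fin l) × EuclideanSpace ℝ (Fin l) =>
      ‖p.2 - σ • p.1‖ ^ 2 := by fun_prop
    exact ((measurable_codeDistSq α).comp measurable_snd).min this.measurable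
  have hGi : Integrable (Function.uncurry G) (μ.prod μ) := by
    refine (hd.comp_snd μ).mono' hGm.aestronglyMeasurable (.of_forall fun p => ?_)
    rw [Function.uncurry_def, Real.norm_of_nonneg (hG0 _ _)]
    exact hGd _ _
  obtain ⟨z, hz⟩ := exists_le_integral hGi.integral_prod_left
  refine ⟨σ • z, ?_⟩
  have hGz : Integrable (G z) μ := by
    refine hd.mono' (hGm.comp measurable_prodMk_left).aestronglyMeasurable
      (.of_forall fun x => ?_)
    rw [Real.norm_of_nonneg (hG0 _ _)]
    exact hGd _ _
  have hins : ∫ x, codeDistSq (insert (σ • z) α) x ∂μ ≤ ∫ x, G z x ∂μ :=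
    integral_mono (integrable_codeDistSq (Finset.insert_nonempty _ _)) hGz
      fun x => codeDistSq_insert_le hα _ _
  have hpt : ∀ x, ∫ z, G z x ∂μ ≤ codeDistSq α x - q * (codeDistSq α x - t x) := by
    intro x
    have hGx : Integrable (fun z => G z x) μ := by
      refine (integrable_const (codeDistSq α x)).mono'
        (hGm.comp measurable_prodMk_right).aestronglyMeasurable (.of_forall fun z => ?_)
      rw [Real.norm_of_nonneg (hG0 _ _)]
      exact hGd _ _
    by_cases hx : codeDistSq α x ≤ t x
    · have h1 : ∫ z, G z x ∂μ ≤ ∫ _, codeDistSq α x ∂μ :=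
        integral_mono hGx (integrable_const _) fun z => hGd z x
      simp only [integral_const, probReal_univ, one_smul] at h1
      nlinarith
    · have hx0 : codeDistSq α x ≤ ‖x‖ ^ 2 := by simpa using codeDistSq_le h0 x
      have hqx := (hball x).resolve_left fun h => hx (hx0.trans h)
      set A := {z : EuclideanSpace ℝ (Fin l) | ‖x - σ • z‖ ^ 2 ≤ t x} with hA
      have hAm : MeasurableSet A := measurableSet_le (by fun_prop) (by fun_prop)
      have hAi : Integrable (A.indicator (1 : EuclideanSpace ℝ (Fin l) → ℝ)) μ :=
        (integrable_indicator_iff hAm).2 (integrable_const _).integrableOn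
      have h1 : ∫ z, G z x ∂μ
          ≤ ∫ z, (codeDistSq α x - (codeDistSq α x - t x) * A.indicator 1 z) ∂μ := by
        refine integral_mono hGx ((integrable_const _).sub (hAi.const_mul _)) fun z => ?_
        by_cases hz : z ∈ A
        · simp only [Set.indicator_of_mem hz, Pi.one_apply, mul_one, sub_sub_cancel]
          exact (min_le_right _ _).trans hz
        · simp only [Set.indicator_of_notMem hz, mul_zero, sub_zero]
          exact hGd z x
      rw [integral_sub (integrable_const _) (hAi.const_mul _), integral_const_mul,
        integral_indicator_one hAm] at h1
      simp only [integral_const, probReal_univ, one_smul] at h1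
      have h2 : 0 < codeDistSq α x - t x := by linarith
      nlinarith
  have hfin : ∫ z, ∫ x, G z x ∂μ ∂μ
      ≤ ∫ x, (codeDistSq α x - q * (codeDistSq α x - t x)) ∂μ := by
    rw [integral_integral_swap hGi]
    exact integral_mono hGi.integral_prod_right (hd.sub ((hd.sub ht).const_mul _)) hpt
  have hsplit : ∫ x, (codeDistSq α x - q * (codeDistSq α x - t x)) ∂μ
      = ∫ x, codeDistSq α x ∂μ - q * (∫ x, codeDistSq α x ∂μ - ∫ x, t x ∂μ) := by
    rw [integral_sub hd (g := fun x => q * (codeDistSq α x - t x)) ((hd.sub ht).const_mul _),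
      integral_const_mul, integral_sub hd ht]
  have hqT : q * (∫ x, codeDistSq α x ∂μ - T)
      ≤ q * (∫ x, codeDistSq α x ∂μ - ∫ x, t x ∂μ) := by gcongr
  have hz' : ∫ x, G z x ∂μ ≤ ∫ z, ∫ x, G z x ∂μ ∂μ := hz
  linarith

lemma exp_half_sq_norm_sub_mul {l : ℕ} (β : ℝ) (a z : EuclideanSpace ℝ (Fin l)) :
    gaussianDensity l z * rexp (1 / 2 * ‖z‖ ^ 2 - β * ‖z - a‖ ^ 2)
      = ((2 * π) ^ ((l : ℝ) / 2))⁻¹ * rexp (-β * ‖z - a‖ ^ 2) := by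
  rw [gaussianDensity, mul_assoc, ← Real.exp_add]
  ring_nf

lemma integrable_exp_half_sq_norm_sub {l : ℕ} {β : ℝ} (hβ : 0 < β)
    (a : EuclideanSpace ℝ (Fin l)) :
    Integrable (fun z => rexp (1 / 2 * ‖z‖ ^ 2 - β * ‖z - a‖ ^ 2)) (_root_.stdGaussian l) := by
  rw [integrable_stdGaussian_iff]
  simp_rw [exp_half_sq_norm_sub_mul]
  exact ((integrable_exp_neg_mul_sq_norm hβ).comp_sub_right a).const_mul _

lemma integral_exp_half_sq_norm_sub {l : ℕ} {β : ℝ} (hβ : 0 < β)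
    (a : EuclideanSpace ℝ (Fin l)) :
    ∫ z, rexp (1 / 2 * ‖z‖ ^ 2 - β * ‖z - a‖ ^ 2) ∂_root_.stdGaussian l
      = ((2 * β) ^ ((l : ℝ) / 2))⁻¹ := by
  rw [integral_stdGaussian]
  simp_rw [exp_half_sq_norm_sub_mul]
  rw [integral_const_mul, integral_sub_right_eq_self (fun z => rexp (-β * ‖z‖ ^ 2)),
    GaussianFourier.integral_rexp_neg_mul_sq_norm hβ, finrank_euclideanSpace, Fintype.card_fin,
    ← Real.inv_rpow (by positivity), ← Real.inv_rpow (by positivity),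
    ← Real.mul_rpow (by positivity) (by positivity)]
  congr 1
  field_simp

/-- Shannon's lower bound for the distortion of a codebook with at most `k` points. -/
lemma le_rpow_mul_integral_codeDistSq {l k : ℕ} (hl : 1 ≤ l)
    {α : Finset (EuclideanSpace ℝ (Fin l))} (hα : α.Nonempty) (hk : α.card ≤ k) :
    (l : ℝ) ≤ (k : ℝ) ^ (2 / (l : ℝ)) * ∫ x, codeDistSq α x ∂_root_.stdGaussian l := by
  have hl' : (0 : ℝ) < l := by exact_mod_cast hl
  have hk' : (0 : ℝ) < k := by exact_mod_cast hα.card_pos.trans_le hk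
  set β : ℝ := 1 / 2 * (k : ℝ) ^ (2 / (l : ℝ)) with hβ
  have hβ0 : 0 < β := by positivity
  have hd := integrable_codeDistSq hα
  have hsq := integrable_sq_norm_stdGaussian l
  have hpt : ∀ x : EuclideanSpace ℝ (Fin l), 1 + (1 / 2 * ‖x‖ ^ 2 - β * codeDistSq α x)
      ≤ ∑ a ∈ α, rexp (1 / 2 * ‖x‖ ^ 2 - β * ‖x - a‖ ^ 2) := by
    intro x
    obtain ⟨a, ha, hax⟩ := exists_codeDistSq_eq hα x
    rw [← hax]
    refine le_trans ?_ (Finset.single_le_sum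
      (f := fun a => rexp (1 / 2 * ‖x‖ ^ 2 - β * ‖x - a‖ ^ 2)) (fun _ _ => by positivity) ha)
    rw [add_comm]
    exact Real.add_one_le_exp _
  have hi : Integrable (fun x => 1 / 2 * ‖x‖ ^ 2 - β * codeDistSq α x) (_root_.stdGaussian l) :=
    (hsq.const_mul _).sub (hd.const_mul _)
  have h := integral_mono ((integrable_const (1 : ℝ)).add hi)
    (integrable_finsetSum α fun a _ => integrable_exp_half_sq_norm_sub hβ0 a) hpt
  rw [integral_finsetSum α fun a _ => integrable_exp_half_sq_norm_sub hβ0 a] at h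
  simp only [Pi.add_apply, integral_exp_half_sq_norm_sub hβ0, Finset.sum_const,
    nsmul_eq_mul] at h
  rw [integral_add (integrable_const _) hi, integral_sub (hsq.const_mul _) (hd.const_mul _),
    integral_const_mul, integral_const_mul, integral_sq_norm_stdGaussian] at h
  have h2β : (2 * β) ^ ((l : ℝ) / 2) = k := by
    rw [hβ, ← mul_assoc, mul_one_div_cancel two_ne_zero, one_mul, ← Real.rpow_mul hk'.le,
      div_mul_div_comm, mul_comm, div_self (by positivity), Real.rpow_one]
  have hc : (α.card : ℝ) * (k : ℝ)⁻¹ ≤ 1 := by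
    rw [← div_eq_mul_inv, div_le_one hk']
    exact_mod_cast hk
  rw [h2β] at h
  simp only [integral_const, probReal_univ, one_smul] at h
  rw [hβ] at h
  linarith

lemma integral_exp_sq_norm_div_le {l : ℕ} (hl : 56 ≤ l) :
    ∫ x, rexp (14 / l * ‖x‖ ^ 2) ∂_root_.stdGaussian l ≤ rexp 28 := by
  have hl' : (56 : ℝ) ≤ l := by exact_mod_cast hl
  have hy : (14 : ℝ) / l ≤ 1 / 4 := by
    rw [div_le_iff₀ (by linarith)]; linarith
  have hy0 : 0 ≤ (14 : ℝ) / l := by positivity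
  rw [integral_exp_mul_sq_norm_stdGaussian (by linarith)]
  set y : ℝ := 14 / l with hydef
  have h1 : rexp (-(4 * y)) ≤ 1 - 2 * y := by
    rw [Real.exp_neg, inv_le_comm₀ (by positivity) (by linarith)]
    refine le_trans ?_ (Real.add_one_le_exp _)
    rw [inv_le_iff_one_le_mul₀ (by linarith)]
    nlinarith
  calc (1 - 2 * y) ^ (-(l : ℝ) / 2) ≤ rexp (-(4 * y)) ^ (-(l : ℝ) / 2) :=
        Real.rpow_le_rpow_of_nonpos (by positivity) h1 (by linarith)
    _ = rexp 28 := by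
        rw [← Real.exp_mul, hydef]
        congr 1
        field_simp
        norm_num

/-- The exponential `exp (7 ‖x‖² / l)`, cut off to the atypical set `‖x‖² > (1 + ε) l`. -/
def farExp (l : ℕ) (ε : ℝ) (x : EuclideanSpace ℝ (Fin l)) : ℝ :=
  {x : EuclideanSpace ℝ (Fin l) | (1 + ε) * l < ‖x‖ ^ 2}.indicator
    (fun x => rexp (7 / l * ‖x‖ ^ 2)) x

lemma integrable_farExp {l : ℕ} (hl : 56 ≤ l) (ε : ℝ) :
    Integrable (farExp l ε) (_root_.stdGaussian l) := by
  have hl' : (56 : ℝ) ≤ l := by exact_mod_cast hl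
  refine Integrable.indicator (integrable_exp_mul_sq_norm_stdGaussian ?_)
    (measurableSet_lt (by fun_prop) (by fun_prop))
  rw [div_lt_iff₀ (by linarith)]
  linarith

lemma eventually_integral_farExp_le {ε η : ℝ} (hε : 0 < ε) (hη : 0 < η) :
    ∀ᶠ l : ℕ in atTop, ∫ x, farExp l ε x ∂_root_.stdGaussian l ≤ η := by
  set V := Var[fun x : ℝ => x ^ 2; gaussianReal 0 1]
  set δ := η / (2 * rexp 28) with hδ
  have hδ0 : 0 < δ := by positivity
  have hlim : Tendsto (fun l : ℕ => 1 / (4 * δ) * (V / (ε ^ 2 * l))) atTop (nhds 0) := by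
    have h := (tendsto_natCast_atTop_atTop (R := ℝ)).const_mul_atTop (sq_pos_of_pos hε)
    simpa using (h.const_div_atTop V).const_mul (1 / (4 * δ))
  filter_upwards [eventually_ge_atTop 56, hlim.eventually_le_const (half_pos hη)] with l hl hlV
  have hl' : (56 : ℝ) ≤ l := by exact_mod_cast hl
  have hi : Integrable (fun x : EuclideanSpace ℝ (Fin l) => rexp (14 / l * ‖x‖ ^ 2))
      (_root_.stdGaussian l) := by
    refine integrable_exp_mul_sq_norm_stdGaussian ?_
    rw [div_lt_iff₀ (by linarith)]
    linarith
  set S := {x : EuclideanSpace ℝ (Fin l) | (1 + ε) * l < ‖x‖ ^ 2} with hS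
  have hSm : MeasurableSet S := measurableSet_lt (by fun_prop) (by fun_prop)
  have hSi : Integrable (S.indicator (1 : EuclideanSpace ℝ (Fin l) → ℝ)) (_root_.stdGaussian l) :=
    (integrable_indicator_iff hSm).2 (integrable_const _).integrableOn
  have hpt : ∀ x, farExp l ε x ≤ δ * rexp (14 / l * ‖x‖ ^ 2) + 1 / (4 * δ) * S.indicator 1 x := by
    intro x
    unfold farExp
    rw [← hS]
    by_cases hx : x ∈ S
    · simp only [Set.indicator_of_mem hx, Pi.one_apply, mul_one]
      have h14 : rexp (14 / l * ‖x‖ ^ 2) = rexp (7 / l * ‖x‖ ^ 2) ^ 2 := by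
        rw [← Real.exp_nat_mul]
        push_cast
        ring_nf
      rw [h14]
      set A := rexp (7 / l * ‖x‖ ^ 2)
      have : δ * A ^ 2 + 1 / (4 * δ) - A = (2 * δ * A - 1) ^ 2 / (4 * δ) := by
        field_simp
        ring
      have : 0 ≤ (2 * δ * A - 1) ^ 2 / (4 * δ) := by positivity
      linarith
    · simp only [Set.indicator_of_notMem hx, mul_zero, add_zero]
      positivity
  have hSV : (_root_.stdGaussian l).real S ≤ V / (ε ^ 2 * l) := by
    refine (measureReal_mono ?_).trans (stdGaussian_sq_norm_deviation_le (by omega) hε)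
    intro x hx
    have hx' : (1 + ε) * l < ‖x‖ ^ 2 := hx
    have hx2 : ε * l ≤ ‖x‖ ^ 2 - l := by linarith
    exact hx2.trans (le_abs_self _)
  have h := integral_mono (integrable_farExp hl ε)
    ((hi.const_mul δ).add (hSi.const_mul (1 / (4 * δ)))) hpt
  simp only [Pi.add_apply] at h
  rw [integral_add (hi.const_mul δ) (hSi.const_mul (1 / (4 * δ))), integral_const_mul,
    integral_const_mul, integral_indicator_one hSm] at h
  have h1 : δ * ∫ x, rexp (14 / l * ‖x‖ ^ 2) ∂_root_.stdGaussian l ≤ η / 2 := by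
    calc _ ≤ δ * rexp 28 := by gcongr; exact integral_exp_sq_norm_div_le hl
      _ = η / 2 := by rw [hδ]; field_simp
  have h2 : 1 / (4 * δ) * (_root_.stdGaussian l).real S ≤ 1 / (4 * δ) * (V / (ε ^ 2 * l)) := by
    gcongr
  linarith

/-- Squared radius of the ball around `x` that serves to cover `x` at distortion level `l * Δ`. -/
def coverRadiusSq (l : ℕ) (ε Δ : ℝ) (x : EuclideanSpace ℝ (Fin l)) : ℝ :=
  l * Δ * (1 + 2 * ε + 7 * farExp l ε x)

set_option maxHeartbeats 1000000 in
lemma sq_norm_le_coverRadiusSq_or {l : ℕ} {ε Δ : ℝ} (hl : 1 ≤ l) (hε0 : 0 < ε) (hε1 : ε < 1)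
    (hlε : 32 ≤ ε ^ 2 * l) (hΔ0 : 0 < Δ) (hΔ1 : Δ < 1)
    (hdev : (_root_.stdGaussian l).real {z | ε * l ≤ |‖z‖ ^ 2 - l|} ≤ 1 / 4)
    (x : EuclideanSpace ℝ (Fin l)) :
    ‖x‖ ^ 2 ≤ coverRadiusSq l ε Δ x ∨
      1 / 2 * (√Δ ^ l * rexp (-(3 * ε * l / 2))) ≤
        (_root_.stdGaussian l).real {z | ‖x - √(1 - Δ) • z‖ ^ 2 ≤ coverRadiusSq l ε Δ x} := by
  have hl1 : (1 : ℝ) ≤ l := by exact_mod_cast hl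
  have hl0 : (0 : ℝ) < l := by linarith
  obtain ⟨b, rfl⟩ : ∃ b, Δ = 1 - b := ⟨1 - Δ, by ring⟩
  have hb0 : 0 < b := by linarith
  have hb1 : b < 1 := by linarith
  rw [sub_sub_cancel]
  have hσ : 0 < √b := Real.sqrt_pos.2 hb0
  have hσ2 : √b ^ 2 = b := Real.sq_sqrt hb0.le
  have hΔs : √(1 - b) ^ 2 = 1 - b := Real.sq_sqrt hΔ0.le
  have hn : 0 ≤ ‖x‖ := norm_nonneg x
  by_cases hx : (1 + ε) * l < ‖x‖ ^ 2
  · have hmem : x ∈ {x : EuclideanSpace ℝ (Fin l) | (1 + ε) * l < ‖x‖ ^ 2} := hx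
    have hfar : farExp l ε x = rexp (7 / l * ‖x‖ ^ 2) := by
      rw [farExp, Set.indicator_of_mem hmem]
    set u := ‖x‖ ^ 2 / l with hu
    have hul : ‖x‖ ^ 2 = u * l := by rw [hu]; field_simp
    have h7u : 7 / (l : ℝ) * ‖x‖ ^ 2 = 7 * u := by rw [hu]; ring
    have hu1 : 1 ≤ u := by
      rw [hu, le_div_iff₀ hl0]
      nlinarith
    have hue : u ≤ rexp (7 * u) := by
      have := Real.add_one_le_exp (7 * u)
      linarith
    rw [h7u] at hfar
    have hrad : 7 * (l * (1 - b) * rexp (7 * u)) ≤ coverRadiusSq l ε (1 - b) x := by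
      rw [coverRadiusSq, hfar]
      have : 0 ≤ l * (1 - b) * (1 + 2 * ε) := by positivity
      linarith
    by_cases hcase : u < (1 - b) * rexp (7 * u)
    · left
      refine le_trans ?_ hrad
      rw [hul]
      nlinarith
    · right
      push Not at hcase
      set s := √(1 - b) * √b * rexp (7 * u / 2) with hs
      have hs0 : 0 < s := by positivity
      have hs2 : s ^ 2 = (1 - b) * b * rexp (7 * u) := by
        rw [hs, mul_pow, mul_pow, hΔs, hσ2, ← Real.exp_nat_mul]
        push_cast
        ring_nf
      have hs2u : s ^ 2 ≤ b * u := by rw [hs2]; nlinarith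
      have hsn : s ≤ ‖x‖ := by
        refine abs_le_of_sq_le_sq' ?_ hn |>.2
        rw [hul]
        nlinarith
      have hsn2 : s * ‖x‖ ≤ ‖x‖ ^ 2 := by rw [sq]; gcongr
      refine le_trans ?_ (le_stdGaussian_ball (b := b) hs0 hσ hb0.le hb1.le hdev x ?_)
      · have hsσ : s / √b = √(1 - b) * rexp (7 * u / 2) := by rw [hs]; field_simp
        rw [hsσ, mul_pow, mul_assoc (√(1 - b) ^ l), ← Real.exp_nat_mul, ← Real.exp_add]
        gcongr
        have e1 : (b ^ 2 * ‖x‖ ^ 2 + 4 * b * s * ‖x‖ + s ^ 2 * ((1 + ε) * l)) / (2 * √b ^ 2)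
            ≤ ‖x‖ ^ 2 / 2 + 2 * ‖x‖ ^ 2 + ‖x‖ ^ 2 := by
          rw [hσ2, div_le_iff₀ (by positivity)]
          have f1 : b ^ 2 * ‖x‖ ^ 2 ≤ b * ‖x‖ ^ 2 := by gcongr; nlinarith
          have f2 : b * (s * ‖x‖) ≤ b * ‖x‖ ^ 2 := by gcongr
          have f3 : s ^ 2 * ((1 + ε) * l) ≤ (b * u) * (2 * l) := by gcongr; linarith
          have f4 : (b * u) * (2 * l) = 2 * b * ‖x‖ ^ 2 := by rw [hul]; ring
          linarith
        have e2 : (l : ℝ) * (7 * u / 2) = 7 / 2 * ‖x‖ ^ 2 := by rw [hul]; ring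
        have e3 : 0 ≤ (1 - ε) * l / 2 := by
          have : 0 < 1 - ε := by linarith
          positivity
        have e4 : 0 < 3 * ε * l / 2 := by positivity
        linarith
      · refine le_trans ?_ hrad
        have f1 : (1 - b) ^ 2 * ‖x‖ ^ 2 ≤ (1 - b) * ‖x‖ ^ 2 := by gcongr; nlinarith
        have f2 : (1 - b) * (s * ‖x‖) ≤ (1 - b) * ‖x‖ ^ 2 := by gcongr
        have f3 : (1 - b) * ‖x‖ ^ 2 ≤ (1 - b) * (rexp (7 * u) * l) := by
          rw [hul]; gcongr
        have f4 : s ^ 2 * ((1 + ε) * l) ≤ ((1 - b) * rexp (7 * u)) * (2 * l) := by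
          gcongr
          · rw [hs2]
            have : 0 < (1 - b) * rexp (7 * u) := by positivity
            nlinarith
          · linarith
        linarith
  · right
    have hmem : x ∉ {x : EuclideanSpace ℝ (Fin l) | (1 + ε) * l < ‖x‖ ^ 2} := hx
    have hnear : farExp l ε x = 0 := by
      rw [farExp, Set.indicator_of_notMem hmem]
    push Not at hx
    have hrad : coverRadiusSq l ε (1 - b) x = l * (1 - b) * (1 + 2 * ε) := by
      rw [coverRadiusSq, hnear]; ring
    rw [hrad]
    set s := √(1 - b) * √b with hs
    have hs0 : 0 < s := by positivity
    have hs2 : s ^ 2 = (1 - b) * b := by rw [hs, mul_pow, hΔs, hσ2]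
    have hs1 : s ≤ 1 := by
      refine abs_le_of_sq_le_sq' ?_ zero_le_one |>.2
      rw [hs2]; nlinarith
    have hxl : ‖x‖ ≤ ε * l / 4 := by
      refine abs_le_of_sq_le_sq' ?_ (by positivity) |>.2
      have : 32 * (l : ℝ) ≤ ε ^ 2 * l * l := by gcongr
      nlinarith
    have hsn : s * ‖x‖ ≤ ε * l / 4 := by
      calc s * ‖x‖ ≤ 1 * ‖x‖ := by gcongr
        _ ≤ _ := by linarith
    refine le_trans ?_ (le_stdGaussian_ball (b := b) hs0 hσ hb0.le hb1.le hdev x ?_)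
    · have hsσ : s / √b = √(1 - b) := by rw [hs]; field_simp
      rw [hsσ]
      gcongr
      have e1 : (b ^ 2 * ‖x‖ ^ 2 + 4 * b * s * ‖x‖ + s ^ 2 * ((1 + ε) * l)) / (2 * √b ^ 2)
          ≤ (1 + ε) * l / 2 + ε * l / 2 := by
        rw [hσ2, div_le_iff₀ (by positivity), hs2]
        have f1 : b ^ 2 * ‖x‖ ^ 2 ≤ b ^ 2 * ((1 + ε) * l) := by gcongr
        have f2 : b * (s * ‖x‖) ≤ b * (ε * l / 4) := by gcongr
        calc b ^ 2 * ‖x‖ ^ 2 + 4 * b * s * ‖x‖ + (1 - b) * b * ((1 + ε) * l)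
            = b ^ 2 * ‖x‖ ^ 2 + 4 * (b * (s * ‖x‖)) + (1 - b) * b * ((1 + ε) * l) := by ring
          _ ≤ b ^ 2 * ((1 + ε) * l) + 4 * (b * (ε * l / 4)) + (1 - b) * b * ((1 + ε) * l) := by
            gcongr
          _ = _ := by ring
      linarith
    · rw [hs2]
      have f1 : (1 - b) ^ 2 * ‖x‖ ^ 2 ≤ (1 - b) ^ 2 * ((1 + ε) * l) := by gcongr
      have f2 : (1 - b) * (s * ‖x‖) ≤ (1 - b) * (ε * l / 4) := by gcongr
      calc (1 - b) ^ 2 * ‖x‖ ^ 2 + 4 * (1 - b) * s * ‖x‖ + (1 - b) * b * ((1 + ε) * l)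
          = (1 - b) ^ 2 * ‖x‖ ^ 2 + 4 * ((1 - b) * (s * ‖x‖)) + (1 - b) * b * ((1 + ε) * l) := by
            ring
        _ ≤ (1 - b) ^ 2 * ((1 + ε) * l) + 4 * ((1 - b) * (ε * l / 4)) +
            (1 - b) * b * ((1 + ε) * l) := by gcongr
        _ = _ := by ring

lemma integral_codeDistSq_le_of_zero_mem {l : ℕ} {α : Finset (EuclideanSpace ℝ (Fin l))}
    (h0 : 0 ∈ α) : ∫ x, codeDistSq α x ∂_root_.stdGaussian l ≤ l := by
  rw [← integral_sq_norm_stdGaussian l]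
  refine integral_mono (integrable_codeDistSq ⟨0, h0⟩) (integrable_sq_norm_stdGaussian l) fun x => ?_
  simpa using codeDistSq_le h0 x

lemma integral_codeDistSq_nonneg {l : ℕ} (α : Finset (EuclideanSpace ℝ (Fin l))) :
    0 ≤ ∫ x, codeDistSq α x ∂_root_.stdGaussian l :=
  integral_nonneg fun x => codeDistSq_nonneg α x

/-- Coefficient in the decrease of the distortion under greedy insertion of a code point. -/
def greedyRate (l : ℕ) (ε : ℝ) : ℝ :=
  ε / (1 + ε) * (1 / 2 * rexp (-(3 * ε * l / 2))) / √(l * (1 + 3 * ε) * (1 + ε)) ^ l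

lemma greedyRate_pos {l : ℕ} {ε : ℝ} (hl : 1 ≤ l) (hε : 0 < ε) : 0 < greedyRate l ε := by
  have hl0 : (0 : ℝ) < l := by exact_mod_cast hl
  unfold greedyRate
  positivity

lemma exists_insert_integral_codeDistSq_le_mul {l : ℕ} {ε : ℝ} (hl : 56 ≤ l) (hε0 : 0 < ε)
    (hε1 : ε < 1) (hlε : 32 ≤ ε ^ 2 * l)
    (hdev : (_root_.stdGaussian l).real {z | ε * l ≤ |‖z‖ ^ 2 - l|} ≤ 1 / 4)
    (hfar : 7 * ∫ x, farExp l ε x ∂_root_.stdGaussian l ≤ ε)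
    {α : Finset (EuclideanSpace ℝ (Fin l))} (h0 : 0 ∈ α)
    (hV : 0 < ∫ x, codeDistSq α x ∂_root_.stdGaussian l) :
    ∃ y, ∫ x, codeDistSq (insert y α) x ∂_root_.stdGaussian l ≤
      (∫ x, codeDistSq α x ∂_root_.stdGaussian l) *
        (1 - greedyRate l ε * √(∫ x, codeDistSq α x ∂_root_.stdGaussian l) ^ l) := by
  have hl0 : (0 : ℝ) < l := by exact_mod_cast (by omega : 0 < l)
  have hVl := integral_codeDistSq_le_of_zero_mem h0
  set V := ∫ x, codeDistSq α x ∂_root_.stdGaussian l with hVdef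
  set K := (l : ℝ) * (1 + 3 * ε) * (1 + ε) with hK
  have hK0 : 0 < K := by positivity
  have hlK : l < K := by
    have : K = l + l * (4 * ε + 3 * ε ^ 2) := by rw [hK]; ring
    have : 0 < l * (4 * ε + 3 * ε ^ 2) := by positivity
    linarith
  have hΔ0 : 0 < V / K := by positivity
  have hΔ1 : V / K < 1 := by rw [div_lt_one hK0]; linarith
  have hfi := integrable_farExp hl ε
  have ht : Integrable (coverRadiusSq l ε (V / K)) (_root_.stdGaussian l) :=
    ((integrable_const _).add (hfi.const_mul 7)).const_mul _
  have hT : ∫ x, coverRadiusSq l ε (V / K) x ∂_root_.stdGaussian l ≤ V / (1 + ε) := by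
    unfold coverRadiusSq
    rw [integral_const_mul, integral_add (integrable_const _) (hfi.const_mul 7),
      integral_const_mul, integral_const]
    simp only [probReal_univ, one_smul]
    calc _ ≤ l * (V / K) * (1 + 2 * ε + ε) := by gcongr
      _ = V / (1 + ε) := by rw [hK]; field_simp; ring
  obtain ⟨y, hy⟩ := exists_insert_integral_codeDistSq_le h0 (√(1 - V / K)) (by positivity) ht hT
    (sq_norm_le_coverRadiusSq_or (by omega) hε0 hε1 hlε hΔ0 hΔ1 hdev)
  refine ⟨y, hy.trans_eq ?_⟩
  rw [← hVdef, greedyRate, ← hK, Real.sqrt_div hV.le, div_pow]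
  have hKl : √K ^ l ≠ 0 := by positivity
  field_simp
  ring

lemma mul_sqrt_pow_le_one_of_le {l k : ℕ} {c V V' : ℝ} (hl : 2 ≤ l) (hk : 1 ≤ k) (hc : 0 ≤ c)
    (hV : 0 ≤ V) (h : c * k * √V ^ l ≤ 1) (hle : V' ≤ V * (1 - c * √V ^ l)) :
    c * (k + 1 : ℕ) * √V' ^ l ≤ 1 := by
  have hk1 : (1 : ℝ) ≤ k := by exact_mod_cast hk
  set z := c * √V ^ l with hz
  have hz0 : 0 ≤ z := by positivity
  have hkz : k * z ≤ 1 := by rw [hz]; linarith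
  have hz1 : z ≤ 1 := by nlinarith
  have hpow : √(1 - z) ^ l ≤ 1 - z := by
    calc √(1 - z) ^ l ≤ √(1 - z) ^ 2 :=
          pow_le_pow_of_le_one (Real.sqrt_nonneg _) (Real.sqrt_le_one.2 (by linarith)) hl
      _ = 1 - z := Real.sq_sqrt (by linarith)
  have hV'l : √V' ^ l ≤ √V ^ l * (1 - z) := by
    calc √V' ^ l ≤ √(V * (1 - z)) ^ l := by gcongr
      _ = √V ^ l * √(1 - z) ^ l := by rw [Real.sqrt_mul hV, mul_pow]
      _ ≤ _ := by gcongr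
  calc c * (k + 1 : ℕ) * √V' ^ l ≤ c * (k + 1 : ℕ) * (√V ^ l * (1 - z)) := by gcongr
    _ = k * z * (1 - z) + z * (1 - z) := by rw [hz]; push_cast; ring
    _ ≤ 1 * (1 - z) + z * (1 - z) := by
      have : 0 ≤ 1 - z := by linarith
      gcongr
    _ ≤ 1 := by nlinarith

lemma exists_greedyRate_mul_sqrt_pow_le_one {l : ℕ} {ε : ℝ} (hl : 56 ≤ l) (hε0 : 0 < ε)
    (hε1 : ε < 1) (hlε : 32 ≤ ε ^ 2 * l)
    (hdev : (_root_.stdGaussian l).real {z | ε * l ≤ |‖z‖ ^ 2 - l|} ≤ 1 / 4)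
    (hfar : 7 * ∫ x, farExp l ε x ∂_root_.stdGaussian l ≤ ε) {k : ℕ} (hk : 1 ≤ k) :
    ∃ α : Finset (EuclideanSpace ℝ (Fin l)), 0 ∈ α ∧ α.card ≤ k ∧
      greedyRate l ε * k * √(∫ x, codeDistSq α x ∂_root_.stdGaussian l) ^ l ≤ 1 := by
  have hl0 : (0 : ℝ) < l := by exact_mod_cast (by omega : 0 < l)
  have hc := greedyRate_pos (l := l) (by omega) hε0
  induction k, hk using Nat.le_induction with
  | base =>
    refine ⟨{0}, by simp, by simp, ?_⟩
    set K := (l : ℝ) * (1 + 3 * ε) * (1 + ε) with hK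
    have hlK : l ≤ K := by
      have : K = l + l * (4 * ε + 3 * ε ^ 2) := by rw [hK]; ring
      have : 0 < l * (4 * ε + 3 * ε ^ 2) := by positivity
      linarith
    have hKl : 0 < √K ^ l := by positivity
    have hVK : √(∫ x, codeDistSq {0} x ∂_root_.stdGaussian l) ^ l ≤ √K ^ l := by
      gcongr
      exact (integral_codeDistSq_le_of_zero_mem (by simp)).trans hlK
    have hexp : rexp (-(3 * ε * l / 2)) ≤ 1 := by
      rw [Real.exp_le_one_iff, Left.neg_nonpos_iff]
      positivity
    have hfrac : ε / (1 + ε) ≤ 1 := by rw [div_le_one (by positivity)]; linarith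
    calc _ ≤ greedyRate l ε * (1 : ℕ) * √K ^ l := by gcongr
      _ = ε / (1 + ε) * (1 / 2 * rexp (-(3 * ε * l / 2))) := by
        rw [greedyRate, ← hK, Nat.cast_one, mul_one, div_mul_cancel₀ _ hKl.ne']
      _ ≤ 1 * (1 / 2 * 1) := by gcongr
      _ ≤ 1 := by norm_num
  | succ k hk ih =>
    obtain ⟨α, h0, hcard, hα⟩ := ih
    rcases (integral_codeDistSq_nonneg α).eq_or_lt with hV | hV
    · refine ⟨α, h0, by omega, ?_⟩
      rw [← hV, Real.sqrt_zero, zero_pow (by omega), mul_zero]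
      exact zero_le_one
    · obtain ⟨y, hy⟩ :=
        exists_insert_integral_codeDistSq_le_mul hl hε0 hε1 hlε hdev hfar h0 hV
      exact ⟨insert y α, by simp [h0], (Finset.card_insert_le _ _).trans (by omega),
        mul_sqrt_pow_le_one_of_le (by omega) hk hc.le hV.le hα hy⟩

lemma inv_greedyRate_rpow {l : ℕ} {ε : ℝ} (hl : 1 ≤ l) (hε : 0 < ε) :
    (greedyRate l ε)⁻¹ ^ (2 / (l : ℝ)) =
      l * (1 + 3 * ε) * (1 + ε) * rexp (3 * ε) * (2 * (1 + ε) / ε) ^ (2 / (l : ℝ)) := by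
  have hl0 : (0 : ℝ) < l := by exact_mod_cast hl
  set K := (l : ℝ) * (1 + 3 * ε) * (1 + ε) with hK
  have hK0 : 0 < K := by positivity
  have h : (greedyRate l ε)⁻¹ = √K ^ l * rexp (3 * ε * l / 2) * (2 * (1 + ε) / ε) := by
    rw [greedyRate, ← hK, Real.exp_neg]
    field_simp
  rw [h, Real.mul_rpow (by positivity) (by positivity),
    Real.mul_rpow (by positivity) (by positivity), ← Real.exp_mul, ← Real.rpow_natCast,
    ← Real.rpow_mul (by positivity), mul_div_cancel₀ _ hl0.ne', Real.rpow_two,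
    Real.sq_sqrt hK0.le]
  congr 3
  field_simp

lemma rpow_mul_le_of_mul_sqrt_pow_le_one {l k : ℕ} {c V : ℝ} (hl : 1 ≤ l) (hc : 0 < c)
    (hV : 0 ≤ V) (h : c * k * √V ^ l ≤ 1) :
    (k : ℝ) ^ (2 / (l : ℝ)) * V ≤ c⁻¹ ^ (2 / (l : ℝ)) := by
  have hl0 : (0 : ℝ) < l := by exact_mod_cast hl
  have hVl : V = (√V ^ l) ^ (2 / (l : ℝ)) := by
    rw [← Real.rpow_natCast, ← Real.rpow_mul (by positivity), mul_div_cancel₀ _ hl0.ne',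
      Real.rpow_two, Real.sq_sqrt hV]
  nth_rewrite 1 [hVl]
  rw [← Real.mul_rpow (by positivity) (by positivity)]
  gcongr
  rw [← one_div, le_div_iff₀ hc]
  linarith

lemma quantErrMeas_nonneg {l : ℕ} (k : ℕ) : 0 ≤ quantErrMeas (_root_.stdGaussian l) k := by
  refine Real.sInf_nonneg ?_
  rintro r ⟨α, -, -, rfl⟩
  exact Real.rpow_nonneg (integral_codeDistSq_nonneg α) _

lemma quantErrMeas_sq_le {l k : ℕ} {α : Finset (EuclideanSpace ℝ (Fin l))} (hα : α.Nonempty)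
    (hk : α.card ≤ k) :
    quantErrMeas (_root_.stdGaussian l) k ^ 2 ≤ ∫ x, codeDistSq α x ∂_root_.stdGaussian l := by
  rw [← Real.sq_sqrt (integral_codeDistSq_nonneg α)]
  refine pow_le_pow_left₀ (quantErrMeas_nonneg k) (csInf_le ⟨0, ?_⟩ ⟨α, hα, hk, ?_⟩) 2
  · rintro r ⟨β, -, -, rfl⟩
    exact Real.rpow_nonneg (integral_codeDistSq_nonneg β) _
  · exact Real.sqrt_eq_rpow _

lemma le_rpow_mul_quantErrMeas_sq {l k : ℕ} (hl : 1 ≤ l) (hk : 1 ≤ k) :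
    (l : ℝ) ≤ (k : ℝ) ^ (2 / (l : ℝ)) * quantErrMeas (_root_.stdGaussian l) k ^ 2 := by
  have hk0 : (0 : ℝ) < k := by exact_mod_cast hk
  have hP : 0 < (k : ℝ) ^ (2 / (l : ℝ)) := by positivity
  have h : √(l / (k : ℝ) ^ (2 / (l : ℝ))) ≤ quantErrMeas (_root_.stdGaussian l) k := by
    refine le_csInf ⟨_, {0}, by simp, by simpa using hk, rfl⟩ ?_
    rintro r ⟨α, hα, hαk, rfl⟩
    rw [← Real.sqrt_eq_rpow]
    refine Real.sqrt_le_sqrt ?_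
    rw [div_le_iff₀' hP]
    exact le_rpow_mul_integral_codeDistSq hl hα hαk
  have h2 := pow_le_pow_left₀ (Real.sqrt_nonneg _) h 2
  rwa [Real.sq_sqrt (by positivity), div_le_iff₀' hP] at h2

lemma eventually_rpow_mul_quantErrMeas_sq_le_mul {ε : ℝ} (hε0 : 0 < ε) (hε1 : ε < 1) :
    ∀ᶠ l : ℕ in atTop, ∀ k : ℕ, 1 ≤ k →
      (k : ℝ) ^ (2 / (l : ℝ)) * quantErrMeas (_root_.stdGaussian l) k ^ 2 ≤
        l * ((1 + 3 * ε) * (1 + ε) * rexp (3 * ε) * (1 + ε)) := by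
  have hcast := tendsto_natCast_atTop_atTop (R := ℝ)
  have hmul := hcast.const_mul_atTop (sq_pos_of_pos hε0)
  have hdev := hmul.const_div_atTop Var[fun x : ℝ => x ^ 2; gaussianReal 0 1]
  have hroot : Tendsto (fun l : ℕ => (2 * (1 + ε) / ε) ^ (2 / (l : ℝ))) atTop (nhds 1) := by
    have h := (tendsto_const_nhds (x := 2 * (1 + ε) / ε)).rpow (hcast.const_div_atTop (2 : ℝ))
      (Or.inl (by positivity : 2 * (1 + ε) / ε ≠ 0))
    simpa using h
  filter_upwards [eventually_ge_atTop 56, hmul.eventually_ge_atTop 32,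
    hdev.eventually_le_const (by norm_num : (0 : ℝ) < 1 / 4),
    hroot.eventually_le_const (by linarith : 1 < 1 + ε),
    eventually_integral_farExp_le hε0 (by positivity : 0 < ε / 7)]
    with l hl hlε hlV hlroot hfar k hk
  have hl1 : 1 ≤ l := by omega
  obtain ⟨α, h0, hcard, hα⟩ := exists_greedyRate_mul_sqrt_pow_le_one hl hε0 hε1 hlε
    ((stdGaussian_sq_norm_deviation_le hl1 hε0).trans hlV) (by linarith) hk
  calc (k : ℝ) ^ (2 / (l : ℝ)) * quantErrMeas (_root_.stdGaussian l) k ^ 2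
      ≤ (k : ℝ) ^ (2 / (l : ℝ)) * ∫ x, codeDistSq α x ∂_root_.stdGaussian l := by
        gcongr
        exact quantErrMeas_sq_le ⟨0, h0⟩ hcard
    _ ≤ (greedyRate l ε)⁻¹ ^ (2 / (l : ℝ)) :=
        rpow_mul_le_of_mul_sqrt_pow_le_one hl1 (greedyRate_pos hl1 hε0)
          (integral_codeDistSq_nonneg α) hα
    _ = l * (1 + 3 * ε) * (1 + ε) * rexp (3 * ε) * (2 * (1 + ε) / ε) ^ (2 / (l : ℝ)) :=
        inv_greedyRate_rpow hl1 hε0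
    _ ≤ l * (1 + 3 * ε) * (1 + ε) * rexp (3 * ε) * (1 + ε) := by gcongr
    _ = _ := by ring

lemma eventually_rpow_mul_quantErrMeas_sq_le {η : ℝ} (hη : 1 < η) :
    ∀ᶠ l : ℕ in atTop, ∀ k : ℕ, 1 ≤ k →
      (k : ℝ) ^ (2 / (l : ℝ)) * quantErrMeas (_root_.stdGaussian l) k ^ 2 ≤ l * η := by
  have hcont : Continuous fun ε : ℝ => (1 + 3 * ε) * (1 + ε) * rexp (3 * ε) * (1 + ε) := by
    fun_prop
  have hev : ∀ᶠ ε : ℝ in nhdsWithin 0 (Set.Ioi 0),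
      (1 + 3 * ε) * (1 + ε) * rexp (3 * ε) * (1 + ε) < η := by
    refine (hcont.tendsto 0).mono_left nhdsWithin_le_nhds |>.eventually_lt_const ?_
    simpa using hη
  obtain ⟨ε, hεη, hε0, hε1⟩ := (hev.and (Ioo_mem_nhdsGT (zero_lt_one' ℝ))).exists
  filter_upwards [eventually_rpow_mul_quantErrMeas_sq_le_mul hε0 hε1] with l hl k hk
  exact (hl k hk).trans (by gcongr)

lemma sInf_eq_one_of_tendsto {f : ℕ → ℝ} (hf : ∀ l, 1 ≤ l → 1 ≤ f l)
    (hlim : Tendsto f atTop (nhds 1)) : sInf {x : ℝ | ∃ l : ℕ, 1 ≤ l ∧ x = f l} = 1 := by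
  have hlow : (1 : ℝ) ∈ lowerBounds {x : ℝ | ∃ l : ℕ, 1 ≤ l ∧ x = f l} := by
    rintro x ⟨l, hl, rfl⟩
    exact hf l hl
  refine le_antisymm (ge_of_tendsto hlim ?_) (le_csInf ⟨f 1, 1, le_rfl, rfl⟩ hlow)
  filter_upwards [eventually_ge_atTop 1] with l hl
  exact csInf_le ⟨1, hlow⟩ ⟨l, hl, rfl⟩

/-- With `C(l) = sup_{k≥1} k^{2/l} e_k(N(0,I_l))²` and `Q(l) = lim_{k→∞} k^{2/l} e_k(N(0,I_l))²`,
one has `lim_{l→∞} C(l)/l = lim_{l→∞} Q(l)/l = inf_{l≥1} C(l)/l = inf_{l≥1} Q(l)/l = 1`. -/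
theorem Cconst_Qconst_asymptotics
    (Q : ℕ → ℝ)
    (hQ : ∀ l : ℕ, 1 ≤ l →
      Tendsto (fun k : ℕ => (k : ℝ) ^ (2 / (l : ℝ)) * (quantErrMeas (stdGaussian l) k) ^ 2)
        atTop (nhds (Q l))) :
    Tendsto (fun l : ℕ => Cconst l / l) atTop (nhds 1)
    ∧ Tendsto (fun l : ℕ => Q l / l) atTop (nhds 1)
    ∧ sInf { x : ℝ | ∃ l : ℕ, 1 ≤ l ∧ x = Cconst l / l } = 1
    ∧ sInf { x : ℝ | ∃ l : ℕ, 1 ≤ l ∧ x = Q l / l } = 1 := by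
  have hbdd : ∀ l : ℕ, 1 ≤ l → BddAbove {x : ℝ | ∃ k : ℕ, 1 ≤ k ∧
      x = (k : ℝ) ^ (2 / (l : ℝ)) * quantErrMeas (_root_.stdGaussian l) k ^ 2} := by
    refine fun l hl => (hQ l hl).bddAbove_range.mono ?_
    rintro x ⟨k, -, rfl⟩
    exact ⟨k, rfl⟩
  have hlQ : ∀ l : ℕ, 1 ≤ l → (l : ℝ) ≤ Q l := by
    intro l hl
    refine ge_of_tendsto (hQ l hl) ?_
    filter_upwards [eventually_ge_atTop 1] with k hk
    exact le_rpow_mul_quantErrMeas_sq hl hk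
  have hQC : ∀ l : ℕ, 1 ≤ l → Q l ≤ Cconst l := by
    intro l hl
    refine le_of_tendsto (hQ l hl) ?_
    filter_upwards [eventually_ge_atTop 1] with k hk
    exact le_csSup (hbdd l hl) ⟨k, hk, rfl⟩
  have hQ1 : ∀ l : ℕ, 1 ≤ l → 1 ≤ Q l / l := by
    intro l hl
    rw [one_le_div (by exact_mod_cast hl)]
    exact hlQ l hl
  have hQC1 : ∀ l : ℕ, 1 ≤ l → Q l / l ≤ Cconst l / l := by
    intro l hl
    gcongr
    exact hQC l hl
  have hC1 : ∀ l : ℕ, 1 ≤ l → 1 ≤ Cconst l / l := fun l hl => (hQ1 l hl).trans (hQC1 l hl)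
  have hClim : Tendsto (fun l : ℕ => Cconst l / l) atTop (nhds 1) := by
    refine tendsto_order.2 ⟨fun a ha => ?_, fun a ha => ?_⟩
    · filter_upwards [eventually_ge_atTop 1] with l hl
      exact ha.trans_le (hC1 l hl)
    · obtain ⟨η, hη1, hηa⟩ := exists_between ha
      filter_upwards [eventually_ge_atTop 1, eventually_rpow_mul_quantErrMeas_sq_le hη1]
        with l hl hle
      have hl0 : (0 : ℝ) < l := by exact_mod_cast hl
      refine lt_of_le_of_lt ?_ hηa
      rw [div_le_iff₀' hl0]
      refine csSup_le ⟨_, 1, le_rfl, rfl⟩ ?_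
      rintro x ⟨k, hk, rfl⟩
      exact hle k hk
  have hQlim : Tendsto (fun l : ℕ => Q l / l) atTop (nhds 1) :=
    tendsto_of_tendsto_of_tendsto_of_le_of_le' tendsto_const_nhds hClim
      ((eventually_ge_atTop 1).mono hQ1) ((eventually_ge_atTop 1).mono hQC1)
  exact ⟨hClim, hQlim, sInf_eq_one_of_tendsto hC1 hClim, sInf_eq_one_of_tendsto hQ1 hQlim⟩
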